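/- arXiv:0712.1611 — 3 statements merged into one kernel-verified Lean document; each statement's English description precedes it below -/
import Mathlib

section
/- There is an absolute constant K > 0 such that the following holds for every odd prime p. Suppose A and B are disjoint subsets of 𝔽_p, f : 𝔽_p → [0,1] has support exactly A ∪ B (f(n) ≠ 0 iff n ∈ A ∪ B), and f(n) ≤ 1 − ε for all n ∈ A, where 0 < ε < 1/3. Suppose β > 0 satisfies ε·β ≥ p^{−1/2}·log p. Then there exists g : 𝔽_p → [0,1] with 𝔼(g) ≥ 𝔼(f) and Λ(g) ≤ Λ(f) + 2β − ε²·p^{−2}·W₀/4 + K/p, where W₀ := Σ_{(a,d) ∈ 𝔽_p × 𝔽_p with a, a+d, a+2d ∈ A} f(a)·f(a+d)·f(a+2d). -/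
noncomputable def Lam (p : ℕ) [NeZero p] (f : ZMod p → ℝ) : ℝ :=
  ((p : ℝ) ^ 2)⁻¹ * ∑ n : ZMod p, ∑ d : ZMod p, f n * f (n + d) * f (n + 2 * d)

noncomputable def Ex (p : ℕ) [NeZero p] (f : ZMod p → ℝ) : ℝ :=
  (p : ℝ)⁻¹ * ∑ n : ZMod p, f n

open Finset

namespace Aux4

variable {p : ℕ} [Fact p.Prime]

lemma sum_shift (F : ZMod p → ℝ) (c : ZMod p) : ∑ v, F (v + c) = ∑ v, F v :=
  Fintype.sum_equiv (Equiv.addRight c) _ _ (fun _ => rfl)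

lemma sum_shift' (F : ZMod p → ℝ) (c : ZMod p) : ∑ v, F (c + v) = ∑ v, F v :=
  Fintype.sum_equiv (Equiv.addLeft c) _ _ (fun _ => rfl)

lemma sum_dil (F : ZMod p → ℝ) (c : ZMod p) (hc : c ≠ 0) : ∑ v, F (c * v) = ∑ v, F v :=
  Fintype.sum_equiv (Equiv.mulLeft₀ c hc) _ _ (fun _ => rfl)

lemma sum_dil' (F : ZMod p → ℝ) (c : ZMod p) (hc : c ≠ 0) : ∑ v, F (v * c) = ∑ v, F v :=
  Fintype.sum_equiv (Equiv.mulRight₀ c hc) _ _ (fun _ => rfl)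

lemma two_ne (hp : Odd p) : (2 : ZMod p) ≠ 0 := by
  have h : ((2 : ℕ) : ZMod p) ≠ 0 := by
    rw [Ne, ZMod.natCast_eq_zero_iff]
    intro h
    have := (Nat.prime_dvd_prime_iff_eq (Fact.out : p.Prime) Nat.prime_two).1 h
    subst this
    revert hp; decide
  simpa using h

/-- triple sums along affine images -/
lemma aff3 (G : ZMod p → ZMod p → ZMod p → ℝ) (a d : ZMod p) (hd : d ≠ 0) :
    ∑ u : ZMod p, ∑ v : ZMod p, G (u * a + v) (u * (a + d) + v) (u * (a + 2 * d) + v)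
      = ∑ x : ZMod p, ∑ e : ZMod p, G x (x + e) (x + 2 * e) := by
  have h1 : ∀ u : ZMod p,
      ∑ v : ZMod p, G (u * a + v) (u * (a + d) + v) (u * (a + 2 * d) + v)
      = ∑ x : ZMod p, G x (x + u * d) (x + 2 * (u * d)) := by
    intro u
    rw [← sum_shift' (fun x => G x (x + u * d) (x + 2 * (u * d))) (u * a)]
    refine Finset.sum_congr rfl fun v _ => ?_
    congr 1 <;> ring
  simp_rw [h1]
  rw [sum_dil' (fun e => ∑ x : ZMod p, G x (x + e) (x + 2 * e)) d hd, Finset.sum_comm]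

lemma aff1 (h : ZMod p → ℝ) (h0 : ∑ x, h x = 0) (x : ZMod p) :
    ∑ u : ZMod p, ∑ v : ZMod p, h (u * x + v) = 0 := by
  refine Finset.sum_eq_zero fun u _ => ?_
  rw [sum_shift', h0]

lemma aff2 (h : ZMod p → ℝ) (h0 : ∑ x, h x = 0) (x y : ZMod p) (hxy : x ≠ y) :
    ∑ u : ZMod p, ∑ v : ZMod p, h (u * x + v) * h (u * y + v) = 0 := by
  have := aff3 (fun a b _ => h a * h b) x (y - x) (sub_ne_zero.2 hxy.symm)
  simp only [add_sub_cancel] at this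
  rw [this]
  refine Finset.sum_eq_zero fun x _ => ?_
  rw [← Finset.mul_sum, sum_shift', h0, mul_zero]

/-- expectation of the trilinear product, off-diagonal -/
lemma expand (f w h : ZMod p → ℝ) (h0 : ∑ x, h x = 0) (h2 : (2 : ZMod p) ≠ 0)
    (n d : ZMod p) (hd : d ≠ 0) :
    ∑ u : ZMod p, ∑ v : ZMod p, (f n + w n * h (u * n + v)) *
        (f (n + d) + w (n + d) * h (u * (n + d) + v)) *
        (f (n + 2 * d) + w (n + 2 * d) * h (u * (n + 2 * d) + v))
      = (p : ℝ) ^ 2 * (f n * f (n + d) * f (n + 2 * d)) + w n * w (n + d) * w (n + 2 * d) *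
        ∑ x : ZMod p, ∑ e : ZMod p, h x * h (x + e) * h (x + 2 * e) := by
  have e1 := aff1 h h0 n
  have e2 := aff1 h h0 (n + d)
  have e3 := aff1 h h0 (n + 2 * d)
  have e12 := aff2 h h0 n (n + d) (by simpa using hd)
  have e13 := aff2 h h0 n (n + 2 * d) (by simp [hd, h2])
  have e23 := aff2 h h0 (n + d) (n + 2 * d) (by
    intro h; apply hd; have := add_left_cancel h; linear_combination -this)
  have e123 := aff3 (fun a b c => h a * h b * h c) n d hd
  rw [← e123]
  set x := n
  set y := n + d
  set z := n + 2 * d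
  have key : ∀ u v : ZMod p, (f x + w x * h (u * x + v)) *
        (f y + w y * h (u * y + v)) * (f z + w z * h (u * z + v))
      = f x * f y * f z + (w x * f y * f z) * h (u * x + v) + (f x * w y * f z) * h (u * y + v)
        + (f x * f y * w z) * h (u * z + v)
        + (w x * w y * f z) * (h (u * x + v) * h (u * y + v))
        + (w x * f y * w z) * (h (u * x + v) * h (u * z + v))
        + (f x * w y * w z) * (h (u * y + v) * h (u * z + v))
        + (w x * w y * w z) * (h (u * x + v) * h (u * y + v) * h (u * z + v)) := by
    intro u v; ring
  simp_rw [key, Finset.sum_add_distrib, ← Finset.mul_sum, e1, e2, e3, e12, e13, e23]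
  simp [ZMod.card]
  ring

/-- variance -/
lemma var_bound (w h : ZMod p → ℝ) (h0 : ∑ x, h x = 0) (hw : ∀ x, w x ∈ Set.Icc (0 : ℝ) 1)
    (hh : ∀ x, h x ∈ Set.Icc (-1 : ℝ) 1) :
    ∑ u : ZMod p, ∑ v : ZMod p, (∑ n, w n * h (u * n + v)) ^ 2 ≤ (p : ℝ) ^ 3 := by
  have h1 : ∀ u v : ZMod p, (∑ n, w n * h (u * n + v)) ^ 2
      = ∑ n, ∑ m, (w n * w m) * (h (u * n + v) * h (u * m + v)) := by
    intro u v
    rw [sq, Finset.sum_mul_sum]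
    refine Finset.sum_congr rfl fun n _ => Finset.sum_congr rfl fun m _ => by ring
  have h2 : ∑ u : ZMod p, ∑ v : ZMod p, (∑ n, w n * h (u * n + v)) ^ 2
      = ∑ n, ∑ m, (w n * w m) * ∑ u : ZMod p, ∑ v : ZMod p, (h (u * n + v) * h (u * m + v)) := by
    simp_rw [h1, Finset.mul_sum]
    calc _ = ∑ u : ZMod p, ∑ n, ∑ v : ZMod p, ∑ m, (w n * w m) * (h (u * n + v) * h (u * m + v)) :=
          Finset.sum_congr rfl fun u _ => Finset.sum_comm
      _ = ∑ n, ∑ u : ZMod p, ∑ v : ZMod p, ∑ m, (w n * w m) * (h (u * n + v) * h (u * m + v)) :=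
          Finset.sum_comm
      _ = ∑ n, ∑ u : ZMod p, ∑ m, ∑ v : ZMod p, (w n * w m) * (h (u * n + v) * h (u * m + v)) :=
          Finset.sum_congr rfl fun n _ => Finset.sum_congr rfl fun u _ => Finset.sum_comm
      _ = _ := Finset.sum_congr rfl fun n _ => Finset.sum_comm
  rw [h2]
  have h3 : ∀ n, ∑ m, (w n * w m) * ∑ u : ZMod p, ∑ v : ZMod p, (h (u * n + v) * h (u * m + v))
      ≤ (p : ℝ) ^ 2 := by
    intro n
    rw [Finset.sum_eq_single n]
    · have a1 : ∑ u : ZMod p, ∑ v : ZMod p, (h (u * n + v) * h (u * n + v)) ≤ (p : ℝ) ^ 2 := by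
        calc _ ≤ ∑ u : ZMod p, ∑ v : ZMod p, (1 : ℝ) :=
              Finset.sum_le_sum fun u _ => Finset.sum_le_sum fun v _ => by
                have := hh (u * n + v); nlinarith [this.1, this.2]
          _ = _ := by simp [ZMod.card]; ring
      have a2 : 0 ≤ ∑ u : ZMod p, ∑ v : ZMod p, (h (u * n + v) * h (u * n + v)) :=
        Finset.sum_nonneg fun u _ => Finset.sum_nonneg fun v _ => mul_self_nonneg _
      have a3 : w n * w n ≤ 1 := by have := hw n; nlinarith [this.1, this.2]
      calc _ ≤ 1 * ∑ u : ZMod p, ∑ v : ZMod p, (h (u * n + v) * h (u * n + v)) :=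
            mul_le_mul_of_nonneg_right a3 a2
        _ ≤ _ := by linarith
    · intro m _ hm
      rw [aff2 h h0 n m hm.symm, mul_zero]
    · simp
  calc _ ≤ ∑ n : ZMod p, (p : ℝ) ^ 2 := Finset.sum_le_sum fun n _ => h3 n
    _ = _ := by simp [ZMod.card]; ring

/-- count of progressions in an interval -/
lemma sum_interval (m : ℕ) (hm : m ≤ p) (F : ZMod p → ℝ) :
    ∑ x : ZMod p, (if x.val < m then (1 : ℝ) else 0) * F x = ∑ i ∈ range m, F (i : ZMod p) := by
  simp_rw [ite_mul, one_mul, zero_mul]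
  rw [← Finset.sum_filter]
  symm
  refine Finset.sum_bij' (fun i _ => (i : ZMod p)) (fun x _ => x.val) ?_ ?_ ?_ ?_ ?_
  · intro i hi
    have := Finset.mem_range.1 hi
    simp [ZMod.val_natCast_of_lt (this.trans_le hm), this]
  · intro x hx
    simpa using hx
  · intro i hi
    have := Finset.mem_range.1 hi
    simp [ZMod.val_natCast_of_lt (this.trans_le hm)]
  · intro x _; simp
  · intro i _; rfl

lemma count (h2 : (2 : ZMod p) ≠ 0) (m : ℕ) (hm : m ≤ p) (s : ZMod p → ℝ)
    (hs : ∀ x, s x = if x.val < m then (1 : ℝ) else 0) :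
    (m : ℝ) ^ 2 / 2 ≤ ∑ a : ZMod p, ∑ d : ZMod p, s a * s (a + d) * s (a + 2 * d) := by
  have h1 : ∀ a : ZMod p, ∑ d : ZMod p, s a * s (a + d) * s (a + 2 * d)
      = s a * ∑ z : ZMod p, s z * s ((a + z) / 2) := by
    intro a
    rw [← sum_shift' (fun z => s z * s ((a + z) / 2)) a,
      ← sum_dil (fun z => s (a + z) * s ((a + (a + z)) / 2)) 2 h2, Finset.mul_sum]
    refine Finset.sum_congr rfl fun d _ => ?_
    have : (a + (a + 2 * d)) / 2 = a + d := by field_simp; ring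
    rw [this]; ring
  simp_rw [h1]
  have h3 : ∀ F : ZMod p → ℝ, ∑ x, s x * F x = ∑ i ∈ range m, F (i : ZMod p) := by
    intro F; simp_rw [hs]; exact sum_interval m hm F
  rw [h3]
  simp_rw [h3]
  have h4 : ∀ i ∈ range m, ∀ j ∈ range m,
      (1 + (-1 : ℝ) ^ i * (-1) ^ j) / 2 ≤ s (((i : ZMod p) + j) / 2) := by
    intro i hi j hj
    rw [Finset.mem_range] at hi hj
    rw [← pow_add]
    rcases Nat.even_or_odd (i + j) with he | ho
    · rw [he.neg_one_pow]
      obtain ⟨k, hk⟩ := he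
      have : ((i : ZMod p) + j) / 2 = (k : ZMod p) := by
        rw [div_eq_iff h2]
        have : ((i + j : ℕ) : ZMod p) = ((k + k : ℕ) : ZMod p) := by rw [hk]
        push_cast at this
        rw [this]; ring
      rw [this, hs, ZMod.val_natCast_of_lt (by omega), if_pos (by omega)]
      norm_num
    · rw [ho.neg_one_pow, hs]
      split_ifs <;> norm_num
  calc (m : ℝ) ^ 2 / 2 ≤ (m : ℝ) ^ 2 / 2 + (∑ i ∈ range m, (-1 : ℝ) ^ i) ^ 2 / 2 := by
        have := sq_nonneg (∑ i ∈ range m, (-1 : ℝ) ^ i); linarith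
    _ = ∑ i ∈ range m, ∑ j ∈ range m, (1 + (-1 : ℝ) ^ i * (-1) ^ j) / 2 := by
        simp_rw [← Finset.sum_div, Finset.sum_add_distrib, ← Finset.mul_sum, ← Finset.sum_mul]
        simp only [Finset.sum_const, Finset.card_range, nsmul_eq_mul, mul_one]
        ring
    _ ≤ _ := Finset.sum_le_sum fun i hi => Finset.sum_le_sum fun j hj => h4 i hi j hj

lemma tri (h2 : (2 : ZMod p) ≠ 0) (m : ℕ) (hm : m ≤ p) (s : ZMod p → ℝ)
    (hs : ∀ x, s x = if x.val < m then (1 : ℝ) else 0) (c : ℝ) (hc0 : 0 ≤ c) (hc1 : c ≤ 1 / 3)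
    (hc : (1 + c) * m = c * p) (h : ZMod p → ℝ) (hh : ∀ x, h x = c - (1 + c) * s x) :
    (∑ x, h x = 0) ∧
    ∑ x : ZMod p, ∑ e : ZMod p, h x * h (x + e) * h (x + 2 * e) ≤ -(p : ℝ) ^ 2 * (c ^ 2 / 3) := by
  have S1 : ∑ x, s x = m := by
    have := sum_interval (p := p) m hm (fun _ => 1)
    simp_rw [hs]
    simpa using this
  have S3 := count h2 m hm s hs
  set N := ∑ a : ZMod p, ∑ d : ZMod p, s a * s (a + d) * s (a + 2 * d) with hN
  constructor
  · simp_rw [hh]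
    rw [Finset.sum_sub_distrib, ← Finset.mul_sum, S1]
    simp [ZMod.card]; linarith
  have T1 : ∑ x : ZMod p, ∑ e : ZMod p, s x = p * m := by
    simp [ZMod.card, ← Finset.mul_sum, S1]
  have T2 : ∑ x : ZMod p, ∑ e : ZMod p, s (x + e) = p * m := by
    simp_rw [sum_shift', S1]; simp [ZMod.card]
  have T3 : ∑ x : ZMod p, ∑ e : ZMod p, s (x + 2 * e) = p * m := by
    have : ∀ x : ZMod p, ∑ e : ZMod p, s (x + 2 * e) = m := fun x => by
      rw [sum_dil (fun e => s (x + e)) 2 h2, sum_shift', S1]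
    simp_rw [this]; simp [ZMod.card]
  have T12 : ∑ x : ZMod p, ∑ e : ZMod p, s x * s (x + e) = m * m := by
    simp_rw [← Finset.mul_sum, sum_shift', S1, ← Finset.sum_mul, S1]
  have T13 : ∑ x : ZMod p, ∑ e : ZMod p, s x * s (x + 2 * e) = m * m := by
    have : ∀ x : ZMod p, ∑ e : ZMod p, s (x + 2 * e) = m := fun x => by
      rw [sum_dil (fun e => s (x + e)) 2 h2, sum_shift', S1]
    simp_rw [← Finset.mul_sum, this, ← Finset.sum_mul, S1]
  have T23 : ∑ x : ZMod p, ∑ e : ZMod p, s (x + e) * s (x + 2 * e) = m * m := by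
    rw [Finset.sum_comm]
    have : ∀ e : ZMod p, ∑ x, s (x + e) * s (x + 2 * e) = ∑ x, s x * s (x + e) := fun e => by
      rw [← sum_shift (fun x => s x * s (x + e)) e]
      refine Finset.sum_congr rfl fun x _ => ?_
      rw [show x + 2 * e = x + e + e by ring]
    simp_rw [this]
    rw [Finset.sum_comm, T12]
  have key : ∀ x e : ZMod p, h x * h (x + e) * h (x + 2 * e) =
      c ^ 3 - c ^ 2 * (1 + c) * s x - c ^ 2 * (1 + c) * s (x + e) - c ^ 2 * (1 + c) * s (x + 2 * e)
      + c * (1 + c) ^ 2 * (s x * s (x + e)) + c * (1 + c) ^ 2 * (s x * s (x + 2 * e))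
      + c * (1 + c) ^ 2 * (s (x + e) * s (x + 2 * e))
      - (1 + c) ^ 3 * (s x * s (x + e) * s (x + 2 * e)) := by
    intro x e; rw [hh, hh, hh]; ring
  have tot : ∑ x : ZMod p, ∑ e : ZMod p, h x * h (x + e) * h (x + 2 * e)
      = c ^ 3 * p ^ 2 - (1 + c) ^ 3 * N := by
    simp only [key, Finset.sum_sub_distrib, Finset.sum_add_distrib]
    simp only [← Finset.mul_sum] at T12 T13 ⊢
    simp only [T1, T2, T3, T12, T13, T23]
    rw [← hN]
    simp [ZMod.card]
    linear_combination (-3 * c ^ 2 * p + 3 * c * ((1 + c) * m + c * p)) * hc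
  rw [tot]
  have : (1 + c) * (c * p) ^ 2 / 2 ≤ (1 + c) ^ 3 * N := by
    rw [← hc]
    calc _ = (1 + c) ^ 3 * ((m : ℝ) ^ 2 / 2) := by ring
      _ ≤ _ := by gcongr
  have h5 : 0 ≤ c ^ 2 * (p : ℝ) ^ 2 * (1 / 3 - c) := by
    apply mul_nonneg (by positivity); linarith
  nlinarith

/-- raising the mean -/
lemma fix (h2 : (2 : ZMod p) ≠ 0) (g : ZMod p → ℝ) (hg : ∀ n, g n ∈ Set.Icc (0 : ℝ) 1) (D : ℝ)
    (hD : D ≤ ∑ n, (1 - g n)) :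
    ∃ g' : ZMod p → ℝ, (∀ n, g' n ∈ Set.Icc (0 : ℝ) 1) ∧ ∑ n, g n + D ≤ ∑ n, g' n ∧
      ∑ n : ZMod p, ∑ d : ZMod p, g' n * g' (n + d) * g' (n + 2 * d) ≤
      ∑ n : ZMod p, ∑ d : ZMod p, g n * g (n + d) * g (n + 2 * d) + 3 * p * max D 0 := by
  rcases le_or_gt D 0 with h | h
  · refine ⟨g, hg, by linarith, ?_⟩
    rw [max_eq_right h]; simp
  rw [max_eq_left h.le]
  set M := ∑ n, (1 - g n) with hM
  have hMpos : 0 < M := by linarith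
  set t := D / M with ht
  have ht0 : 0 ≤ t := by positivity
  have ht1 : t ≤ 1 := (div_le_one hMpos).2 hD
  have htM : t * M = D := by rw [ht]; field_simp
  set r : ZMod p → ℝ := fun n => t * (1 - g n) with hr
  have hr0 : ∀ n, 0 ≤ r n := fun n => mul_nonneg ht0 (by linarith [(hg n).2])
  have hrs : ∑ n, r n = D := by rw [hr, ← Finset.mul_sum, ← hM, htM]
  have hg' : ∀ n, g n + r n ∈ Set.Icc (0 : ℝ) 1 := by
    intro n
    refine ⟨add_nonneg (hg n).1 (hr0 n), ?_⟩
    have : r n ≤ 1 * (1 - g n) := mul_le_mul_of_nonneg_right ht1 (by linarith [(hg n).2])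
    linarith
  refine ⟨fun n => g n + r n, hg', ?_, ?_⟩
  · rw [Finset.sum_add_distrib, hrs]
  have pt : ∀ n d : ZMod p, (g n + r n) * (g (n + d) + r (n + d)) * (g (n + 2 * d) + r (n + 2 * d))
      ≤ g n * g (n + d) * g (n + 2 * d) + (r n + r (n + d) + r (n + 2 * d)) := by
    intro n d
    have A : ∀ a b c : ℝ, 0 ≤ a → b ∈ Set.Icc (0 : ℝ) 1 → c ∈ Set.Icc (0 : ℝ) 1 →
        a * b * c ≤ a := by
      intro a b c ha hb hc
      calc a * b * c = a * (b * c) := by ring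
        _ ≤ a * 1 := mul_le_mul_of_nonneg_left (mul_le_one₀ hb.2 hc.1 hc.2) ha
        _ = a := mul_one a
    have A1 := A (r n) _ _ (hr0 n) (hg' (n + d)) (hg' (n + 2 * d))
    have A2 := A (r (n + d)) _ _ (hr0 _) (hg n) (hg' (n + 2 * d))
    have A3 := A (r (n + 2 * d)) _ _ (hr0 _) (hg n) (hg (n + d))
    linarith
  have R2 : ∑ x : ZMod p, ∑ e : ZMod p, r x = p * D := by
    simp [ZMod.card, ← Finset.mul_sum, hrs]
  have R1 : ∑ x : ZMod p, ∑ e : ZMod p, r (x + e) = p * D := by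
    simp_rw [sum_shift', hrs]; simp [ZMod.card]
  have R3 : ∑ x : ZMod p, ∑ e : ZMod p, r (x + 2 * e) = p * D := by
    have : ∀ x : ZMod p, ∑ e : ZMod p, r (x + 2 * e) = D := fun x => by
      rw [sum_dil (fun e => r (x + e)) 2 h2, sum_shift', hrs]
    simp_rw [this]; simp [ZMod.card]
  calc _ ≤ ∑ n : ZMod p, ∑ d : ZMod p,
        (g n * g (n + d) * g (n + 2 * d) + (r n + r (n + d) + r (n + 2 * d))) :=
        Finset.sum_le_sum fun n _ => Finset.sum_le_sum fun d _ => pt n d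
    _ = _ := by
        simp_rw [Finset.sum_add_distrib]
        rw [R1, R2, R3]; ring

/-- average over all affine maps -/
lemma avg (h2 : (2 : ZMod p) ≠ 0) (f w h : ZMod p → ℝ) (h0 : ∑ x, h x = 0)
    (hf : ∀ x, f x ∈ Set.Icc (0 : ℝ) 1)
    (hw : ∀ x, w x ∈ Set.Icc (0 : ℝ) 1) (hh : ∀ x, h x ∈ Set.Icc (-1 : ℝ) 1)
    (hg : ∀ x y, f x + w x * h y ∈ Set.Icc (0 : ℝ) 1) :
    ∑ u : ZMod p, ∑ v : ZMod p, ∑ n : ZMod p, ∑ d : ZMod p, (f n + w n * h (u * n + v)) *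
        (f (n + d) + w (n + d) * h (u * (n + d) + v)) *
        (f (n + 2 * d) + w (n + 2 * d) * h (u * (n + 2 * d) + v))
    ≤ (p : ℝ) ^ 2 * ∑ n : ZMod p, ∑ d : ZMod p, f n * f (n + d) * f (n + 2 * d)
      + (∑ n : ZMod p, ∑ d : ZMod p, w n * w (n + d) * w (n + 2 * d)) *
        (∑ x : ZMod p, ∑ e : ZMod p, h x * h (x + e) * h (x + 2 * e)) + 2 * (p : ℝ) ^ 3 := by
  set T := ∑ x : ZMod p, ∑ e : ZMod p, h x * h (x + e) * h (x + 2 * e) with hT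
  have hTl : -(p : ℝ) ^ 2 ≤ T := by
    calc -(p : ℝ) ^ 2 = ∑ x : ZMod p, ∑ e : ZMod p, (-1 : ℝ) := by simp [ZMod.card]; ring
      _ ≤ T := Finset.sum_le_sum fun x _ => Finset.sum_le_sum fun e _ => by
        have h3 : |h x * h (x + e) * h (x + 2 * e)| ≤ 1 := by
          rw [abs_mul, abs_mul]
          have a := fun x => abs_le.2 (hh x)
          exact mul_le_one₀ (mul_le_one₀ (a _) (abs_nonneg _) (a _)) (abs_nonneg _) (a _)
        exact (abs_le.1 h3).1
  have prod1 : ∀ a b c : ℝ, a ∈ Set.Icc (0 : ℝ) 1 → b ∈ Set.Icc (0 : ℝ) 1 →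
      c ∈ Set.Icc (0 : ℝ) 1 → a * b * c ∈ Set.Icc (0 : ℝ) 1 := fun a b c ha hb hc =>
    ⟨mul_nonneg (mul_nonneg ha.1 hb.1) hc.1,
      mul_le_one₀ (mul_le_one₀ ha.2 hb.1 hb.2) hc.1 hc.2⟩
  have swap : ∀ Φ : ZMod p → ZMod p → ZMod p → ZMod p → ℝ,
      ∑ u, ∑ v, ∑ n, ∑ d, Φ u v n d = ∑ n, ∑ d, ∑ u, ∑ v, Φ u v n d := by
    intro Φ
    calc _ = ∑ u, ∑ n, ∑ v, ∑ d, Φ u v n d := Finset.sum_congr rfl fun u _ => Finset.sum_comm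
      _ = ∑ n, ∑ u, ∑ v, ∑ d, Φ u v n d := Finset.sum_comm
      _ = ∑ n, ∑ u, ∑ d, ∑ v, Φ u v n d :=
        Finset.sum_congr rfl fun n _ => Finset.sum_congr rfl fun u _ => Finset.sum_comm
      _ = _ := Finset.sum_congr rfl fun n _ => Finset.sum_comm
  rw [swap]
  have pt : ∀ n d : ZMod p, ∑ u : ZMod p, ∑ v : ZMod p, (f n + w n * h (u * n + v)) *
        (f (n + d) + w (n + d) * h (u * (n + d) + v)) *
        (f (n + 2 * d) + w (n + 2 * d) * h (u * (n + 2 * d) + v))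
      ≤ (p : ℝ) ^ 2 * (f n * f (n + d) * f (n + 2 * d)) + w n * w (n + d) * w (n + 2 * d) * T
        + (if d = 0 then 2 * (p : ℝ) ^ 2 else 0) := by
    intro n d
    by_cases hd : d = 0
    · rw [if_pos hd]
      have a1 : ∑ u : ZMod p, ∑ v : ZMod p, (f n + w n * h (u * n + v)) *
        (f (n + d) + w (n + d) * h (u * (n + d) + v)) *
        (f (n + 2 * d) + w (n + 2 * d) * h (u * (n + 2 * d) + v)) ≤ (p : ℝ) ^ 2 := by
        calc _ ≤ ∑ u : ZMod p, ∑ v : ZMod p, (1 : ℝ) :=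
              Finset.sum_le_sum fun u _ => Finset.sum_le_sum fun v _ =>
                (prod1 _ _ _ (hg _ _) (hg _ _) (hg _ _)).2
          _ = _ := by simp [ZMod.card]; ring
      have a2 := (prod1 _ _ _ (hf n) (hf (n + d)) (hf (n + 2 * d))).1
      have a3 := prod1 _ _ _ (hw n) (hw (n + d)) (hw (n + 2 * d))
      have a4 : 0 ≤ (p : ℝ) ^ 2 * (f n * f (n + d) * f (n + 2 * d)) := by positivity
      have a5 : -(p : ℝ) ^ 2 ≤ w n * w (n + d) * w (n + 2 * d) * T := by
        have b1 := mul_le_mul_of_nonneg_left hTl a3.1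
        have b2 := mul_le_mul_of_nonneg_right a3.2 (sq_nonneg (p : ℝ))
        linarith
      linarith
    · rw [if_neg hd, expand f w h h0 h2 n d hd, add_zero]
  calc _ ≤ ∑ n : ZMod p, ∑ d : ZMod p, ((p : ℝ) ^ 2 * (f n * f (n + d) * f (n + 2 * d))
        + w n * w (n + d) * w (n + 2 * d) * T + (if d = 0 then 2 * (p : ℝ) ^ 2 else 0)) :=
        Finset.sum_le_sum fun n _ => Finset.sum_le_sum fun d _ => pt n d
    _ = _ := by
        simp_rw [Finset.sum_add_distrib, ← Finset.mul_sum, ← Finset.sum_mul]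
        simp [ZMod.card]; ring

lemma choose_c (ε : ℝ) (h0 : 0 < ε) (h1 : ε < 1 / 3) (p : ℕ) (hp : 0 < p) :
    ∃ (m : ℕ) (c : ℝ), m ≤ p ∧ 0 ≤ c ∧ c ≤ ε ∧ (1 + c) * m = c * p ∧
      ε ^ 2 / 4 - 1 / p ≤ c ^ 2 / 3 := by
  have hpR : (0 : ℝ) < p := by exact_mod_cast hp
  set δ := ε / (1 + ε) with hδ
  have hδ0 : 0 ≤ δ := by positivity
  have hδe : δ * (1 + ε) = ε := by rw [hδ]; field_simp
  have hδ1 : δ ≤ 1 / 4 := by nlinarith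
  set m := ⌊δ * p⌋₊ with hm
  have m1 : (m : ℝ) ≤ δ * p := Nat.floor_le (by positivity)
  have m2 : δ * p < m + 1 := Nat.lt_floor_add_one _
  have m3 : (m : ℝ) ≤ p / 4 := by nlinarith
  have hq : 0 < (p : ℝ) - m := by linarith
  have m0 : (0 : ℝ) ≤ m := by positivity
  set c := (m : ℝ) / (p - m) with hc
  have hcq : c * (p - m) = m := by rw [hc]; field_simp
  have hc0 : 0 ≤ c := by positivity
  have hce : c ≤ ε := by
    rw [hc, div_le_iff₀ hq]; nlinarith
  refine ⟨m, c, ?_, hc0, hce, by linarith, ?_⟩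
  · have : (m : ℝ) ≤ p := by linarith
    exact_mod_cast this
  -- `(ε - c) p ≤ 2`
  have hd : (ε - c) * p ≤ 2 := by
    -- `(ε - c)(p-m) = ε p - (1+ε) m ≤ 1 + ε`
    have e1 : (ε - c) * (p - m) ≤ 1 + ε := by nlinarith
    have e2 : (ε - c) * (p * (3 / 4)) ≤ (ε - c) * (p - m) :=
      mul_le_mul_of_nonneg_left (by linarith) (by linarith)
    nlinarith
  have hd2 : ε - c ≤ 2 / p := by rw [le_div_iff₀ hpR]; exact hd
  have : (2 : ℝ) / p = 2 * (1 / p) := by ring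
  rw [this] at hd2
  have hx : 0 ≤ 1 / (p : ℝ) := by positivity
  have : (ε - c) * (ε + c) ≤ 2 * (1 / p) * (2 / 3) :=
    mul_le_mul hd2 (by linarith) (by linarith) (by linarith)
  nlinarith

end Aux4

open Aux4
theorem stmt_4 :
    ∃ K : ℝ, 0 < K ∧
      ∀ (p : ℕ) [Fact p.Prime], Odd p →
        ∀ (A B : Finset (ZMod p)), Disjoint A B →
          ∀ f : ZMod p → ℝ, (∀ n, f n ∈ Set.Icc (0 : ℝ) 1) →
            (∀ n, f n ≠ 0 ↔ n ∈ A ∪ B) →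
            ∀ ε : ℝ, 0 < ε → ε < 1/3 →
              (∀ n ∈ A, f n ≤ 1 - ε) →
              ∀ β : ℝ, 0 < β → ε * β ≥ (p : ℝ) ^ (-(1 : ℝ)/2) * Real.log p →
                ∃ g : ZMod p → ℝ, (∀ n, g n ∈ Set.Icc (0 : ℝ) 1) ∧
                  Ex p g ≥ Ex p f ∧
                  Lam p g ≤ Lam p f + 2 * β -
                    ε ^ 2 * ((p : ℝ) ^ 2)⁻¹ *
                      (∑ a : ZMod p, ∑ d : ZMod p,
                        if a ∈ A ∧ a + d ∈ A ∧ a + 2 * d ∈ A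
                        then f a * f (a + d) * f (a + 2 * d) else 0) / 4 +
                    K / p := by
  refine ⟨3, by norm_num, ?_⟩
  intro p _ hodd A B _ f hf _ ε hε0 hε1 hA β hβ hεβ
  have h2 := two_ne (p := p) hodd
  have hp3 : 3 ≤ p := by
    have := (Fact.out : p.Prime).two_le
    rcases hodd with ⟨k, hk⟩; omega
  have hpR : (3 : ℝ) ≤ p := by exact_mod_cast hp3
  have hp0 : (0 : ℝ) < p := by linarith
  obtain ⟨m, c, hmp, hc0, hcε, hcm, hcc⟩ := choose_c ε hε0 hε1 p (by omega)
  set s : ZMod p → ℝ := fun x => if x.val < m then (1 : ℝ) else 0 with hs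
  set h : ZMod p → ℝ := fun x => c - (1 + c) * s x with hh
  obtain ⟨h0, hT⟩ := tri h2 m hmp s (fun _ => rfl) c hc0 (by linarith) hcm h (fun _ => rfl)
  set w : ZMod p → ℝ := fun x => if x ∈ A then f x else 0 with hw
  have hhe : ∀ x, h x ∈ Set.Icc (-1 : ℝ) ε := by
    intro x
    simp only [hh, hs]
    split_ifs <;> constructor <;> linarith
  have hh1 : ∀ x, h x ∈ Set.Icc (-1 : ℝ) 1 := fun x => ⟨(hhe x).1, (hhe x).2.trans (by linarith)⟩
  have hw1 : ∀ x, w x ∈ Set.Icc (0 : ℝ) 1 := by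
    intro x
    simp only [hw]
    split_ifs
    · exact hf x
    · simp
  have hg : ∀ x y, f x + w x * h y ∈ Set.Icc (0 : ℝ) 1 := by
    intro x y
    simp only [hw]
    split_ifs with hx
    · have a := hf x
      have b := hhe y
      have c1 := hA x hx
      constructor
      · nlinarith [mul_nonneg a.1 (by linarith [b.1] : 0 ≤ 1 + h y)]
      · have := mul_le_mul_of_nonneg_left b.2 a.1
        nlinarith [mul_le_mul_of_nonneg_right c1 (by linarith : 0 ≤ 1 + ε)]
    · simpa using hf x
  have hW : (∑ a : ZMod p, ∑ d : ZMod p,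
      if a ∈ A ∧ a + d ∈ A ∧ a + 2 * d ∈ A then f a * f (a + d) * f (a + 2 * d) else 0)
      = ∑ n : ZMod p, ∑ d : ZMod p, w n * w (n + d) * w (n + 2 * d) := by
    refine Finset.sum_congr rfl fun a _ => Finset.sum_congr rfl fun d _ => ?_
    simp only [hw]
    by_cases x1 : a ∈ A <;> by_cases x2 : a + d ∈ A <;> by_cases x3 : a + 2 * d ∈ A <;>
      simp [x1, x2, x3]
  rw [hW]
  have hav := avg h2 f w h h0 hf hw1 hh1 hg
  have hvar := var_bound w h h0 hw1 hh1
  set T := ∑ x : ZMod p, ∑ e : ZMod p, h x * h (x + e) * h (x + 2 * e) with hTdef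
  set W := ∑ n : ZMod p, ∑ d : ZMod p, w n * w (n + d) * w (n + 2 * d) with hWdef
  set F := ∑ n : ZMod p, ∑ d : ZMod p, f n * f (n + d) * f (n + 2 * d) with hFdef
  have hW0 : 0 ≤ W := Finset.sum_nonneg fun n _ => Finset.sum_nonneg fun d _ =>
    mul_nonneg (mul_nonneg (hw1 _).1 (hw1 _).1) (hw1 _).1
  have hW1 : W ≤ (p : ℝ) ^ 2 := by
    calc W ≤ ∑ n : ZMod p, ∑ d : ZMod p, (1 : ℝ) :=
          Finset.sum_le_sum fun n _ => Finset.sum_le_sum fun d _ =>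
            mul_le_one₀ (mul_le_one₀ (hw1 _).2 (hw1 _).1 (hw1 _).2) (hw1 _).1 (hw1 _).2
      _ = _ := by simp [ZMod.card]; ring
  -- square root of p
  set q := Real.sqrt p with hq
  have hq0 : 0 < q := Real.sqrt_pos.2 hp0
  have hqq : q * q = p := Real.mul_self_sqrt hp0.le
  have hβ3 : 3 / q ≤ β := by
    have hpow : (p : ℝ) ^ (-(1 : ℝ) / 2) = 1 / q := by
      rw [neg_div, Real.rpow_neg hp0.le, ← Real.sqrt_eq_rpow, one_div]
    rw [hpow] at hεβ
    have hlog : 1 ≤ Real.log p := by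
      rw [Real.le_log_iff_exp_le hp0]
      have := Real.exp_one_lt_d9
      linarith
    have a1 : 1 / q * 1 ≤ 1 / q * Real.log p := mul_le_mul_of_nonneg_left hlog (by positivity)
    have a2 : ε * β ≤ 1 / 3 * β := mul_le_mul_of_nonneg_right hε1.le hβ.le
    have : 3 / q = 3 * (1 / q) := by ring
    linarith
  -- choose u, v
  set X : ZMod p → ZMod p → ℝ := fun u v =>
    (∑ n : ZMod p, ∑ d : ZMod p, (f n + w n * h (u * n + v)) *
        (f (n + d) + w (n + d) * h (u * (n + d) + v)) *
        (f (n + 2 * d) + w (n + 2 * d) * h (u * (n + 2 * d) + v)))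
      + 3 / 2 * q * (∑ n, w n * h (u * n + v)) ^ 2 with hX
  set Y := F + W * T / (p : ℝ) ^ 2 + 2 * p + 3 / 2 * q * p with hY
  have hex : ∃ u v, X u v ≤ Y := by
    have hsum : ∑ i : ZMod p × ZMod p, X i.1 i.2 ≤ ∑ i : ZMod p × ZMod p, Y := by
      rw [Fintype.sum_prod_type]
      simp only [hX, Finset.sum_add_distrib, ← Finset.mul_sum]
      have e : ∑ i : ZMod p × ZMod p, Y = (p : ℝ) ^ 2 * F + W * T + 2 * p ^ 3
          + 3 / 2 * q * p ^ 3 := by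
        simp only [Finset.sum_const, Finset.card_univ, Fintype.card_prod, ZMod.card, nsmul_eq_mul,
          Nat.cast_mul, hY]
        field_simp
      rw [e]
      have := mul_le_mul_of_nonneg_left hvar (by positivity : 0 ≤ 3 / 2 * q)
      linarith
    obtain ⟨i, _, hi⟩ := Finset.exists_le_of_sum_le Finset.univ_nonempty hsum
    exact ⟨i.1, i.2, hi⟩
  obtain ⟨u, v, huv⟩ := hex
  set g0 : ZMod p → ℝ := fun n => f n + w n * h (u * n + v) with hg0
  set S := ∑ n, w n * h (u * n + v) with hS
  have hg0s : ∑ n, g0 n = ∑ n, f n + S := by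
    simp only [hg0, Finset.sum_add_distrib, hS]
  have hD : -S ≤ ∑ n, (1 - g0 n) := by
    rw [Finset.sum_sub_distrib, hg0s, ← sub_sub, ← Finset.sum_sub_distrib]
    have : 0 ≤ ∑ n, (1 - f n) := Finset.sum_nonneg fun n _ => by linarith [(hf n).2]
    linarith
  obtain ⟨g, hg1, hg2, hg3⟩ := fix h2 g0 (fun n => hg _ _) (-S) hD
  refine ⟨g, hg1, ?_, ?_⟩
  · unfold Ex
    rw [hg0s] at hg2
    exact mul_le_mul_of_nonneg_left (by linarith) (by positivity)
  unfold Lam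
  rw [← hFdef]
  set G := ∑ n : ZMod p, ∑ d : ZMod p, g n * g (n + d) * g (n + 2 * d) with hG
  have hmax : 3 * p * max (-S) 0 ≤ 3 / 2 * q * S ^ 2 + 3 / 2 * q * p := by
    rw [← hqq]
    rcases le_total (-S) 0 with hs0 | hs0
    · rw [max_eq_right hs0, mul_zero]; positivity
    · rw [max_eq_left hs0]
      nlinarith [mul_nonneg hq0.le (sq_nonneg (S + q))]
  have hx : (∑ n : ZMod p, ∑ d : ZMod p, g0 n * g0 (n + d) * g0 (n + 2 * d))
      + 3 / 2 * q * S ^ 2 ≤ Y := huv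
  have hWT : W * T / (p : ℝ) ^ 2 ≤ - (ε ^ 2 * W / 4) + p := by
    have b1 : T / (p : ℝ) ^ 2 ≤ -(ε ^ 2 / 4) + 1 / p := by
      rw [div_le_iff₀ (by positivity)]
      have := mul_le_mul_of_nonneg_left hcc (sq_nonneg (p : ℝ))
      linarith
    have b2 := mul_le_mul_of_nonneg_left b1 hW0
    have b3 : W * (1 / p) ≤ p := by
      rw [mul_one_div, div_le_iff₀ hp0]; linarith
    rw [mul_div_assoc]
    linarith
  have hqβ : 3 * q * p ≤ β * (p : ℝ) ^ 2 := by
    rw [div_le_iff₀ hq0] at hβ3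
    have := mul_le_mul_of_nonneg_right hβ3 (by positivity : 0 ≤ q * p)
    calc 3 * q * p = 3 * (q * p) := by ring
      _ ≤ _ := this
      _ = β * (q * q) * p := by ring
      _ = _ := by rw [hqq]; ring
  have hfin : G ≤ F - ε ^ 2 * W / 4 + 3 * p + 2 * β * (p : ℝ) ^ 2 := by
    have : 0 ≤ β * (p : ℝ) ^ 2 := by positivity
    linarith
  have hlast := mul_le_mul_of_nonneg_left hfin (by positivity : 0 ≤ ((p : ℝ) ^ 2)⁻¹)
  refine hlast.trans (le_of_eq ?_)
  field_simp
  ring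
end

section
/- There is an absolute constant C > 0 such that the following holds: for every prime p, every integer N with 2 ≤ N ≤ p, and every subset S ⊆ 𝔽_p with |S| ≥ 2·(r₃(N)/N)·p, one has Λ(S) ≥ 2·r₃(N) / (N³ + C·N²). (A quantitative version of Varnavides's theorem.) -/
noncomputable def ind (p : ℕ) [NeZero p] (S : Finset (ZMod p)) : ZMod p → ℝ :=
  fun n => if n ∈ S then 1 else 0

/-- `r3 N` is the largest size of a subset of `{1, …, N}` containing no triple
`(x, y, z)` with `x + y = 2 * z` and `x ≠ y`. -/
noncomputable def r3 (N : ℕ) : ℕ :=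
  sSup {k : ℕ | ∃ A : Finset ℕ, A ⊆ Finset.Icc 1 N ∧ A.card = k ∧
    ∀ x ∈ A, ∀ y ∈ A, ∀ z ∈ A, x + y = 2 * z → x = y}

open Finset in
theorem le_r3 (N : ℕ) (A : Finset ℕ) (hA : A ⊆ Finset.Icc 1 N)
    (h : ∀ x ∈ A, ∀ y ∈ A, ∀ z ∈ A, x + y = 2 * z → x = y) : A.card ≤ r3 N := by
  unfold r3
  apply le_csSup
  · refine ⟨N, ?_⟩
    rintro k ⟨B, hB, rfl, -⟩
    simpa using Finset.card_le_card hB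
  · exact ⟨A, hA, rfl, h⟩

theorem card_le_aux (N : ℕ) (A : Finset ℕ) (hA : A ⊆ Finset.Icc 1 N) :
    A.card ≤ r3 N + (((Finset.Icc 1 N) ×ˢ (Finset.Ico 1 N)).filter
      (fun q : ℕ × ℕ => q.1 ∈ A ∧ q.1 + q.2 ∈ A ∧ q.1 + 2 * q.2 ∈ A)).card := by
  classical
  set F := ((Finset.Icc 1 N) ×ˢ (Finset.Ico 1 N)).filter
      (fun q : ℕ × ℕ => q.1 ∈ A ∧ q.1 + q.2 ∈ A ∧ q.1 + 2 * q.2 ∈ A) with hF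
  have h1 : (A \ F.image Prod.fst).card ≤ r3 N := by
    apply le_r3 N _ (Finset.sdiff_subset.trans hA)
    have key : ∀ x ∈ A \ F.image Prod.fst, ∀ y ∈ A, ∀ z ∈ A, x + y = 2 * z → ¬ x < y := by
      intro x hx y hy z hz hxyz hlt
      rw [Finset.mem_sdiff] at hx
      apply hx.2
      rw [Finset.mem_image]
      have hx' := Finset.mem_Icc.1 (hA hx.1)
      have hy' := Finset.mem_Icc.1 (hA hy)
      refine ⟨(x, z - x), ?_, rfl⟩
      rw [hF, Finset.mem_filter, Finset.mem_product, Finset.mem_Icc, Finset.mem_Ico]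
      refine ⟨⟨hx', by dsimp only; omega, by dsimp only; omega⟩, hx.1, ?_, ?_⟩
      · have : x + (z - x) = z := by omega
        simpa [this] using hz
      · have : x + 2 * (z - x) = y := by omega
        simpa [this] using hy
    intro x hx y hy z hz hxyz
    have a1 := key x hx y (Finset.mem_sdiff.1 hy).1 z (Finset.mem_sdiff.1 hz).1 hxyz
    have a2 := key y hy x (Finset.mem_sdiff.1 hx).1 z (Finset.mem_sdiff.1 hz).1 (by omega)
    omega
  have h2 : (F.image Prod.fst).card ≤ F.card := Finset.card_image_le
  have h3 : A.card ≤ (A \ F.image Prod.fst).card + (F.image Prod.fst).card := by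
    have := Finset.le_card_sdiff (F.image Prod.fst) A
    omega
  omega

theorem pointwise_aux (p : ℕ) [NeZero p] (N : ℕ) (S : Finset (ZMod p)) (a d : ZMod p) :
    ∑ i ∈ Finset.Icc 1 N, ind p S (a + d * i) ≤ r3 N +
      ∑ q ∈ (Finset.Icc 1 N) ×ˢ (Finset.Ico 1 N), ind p S (a + d * (q.1 : ℕ)) *
        ind p S (a + d * (q.1 : ℕ) + d * (q.2 : ℕ)) *
        ind p S (a + d * (q.1 : ℕ) + 2 * (d * (q.2 : ℕ))) := by
  classical
  have h := card_le_aux N ((Finset.Icc 1 N).filter (fun i : ℕ => a + d * i ∈ S))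
    (Finset.filter_subset _ _)
  have e1 : ∑ i ∈ Finset.Icc 1 N, ind p S (a + d * i) =
      (((Finset.Icc 1 N).filter (fun i : ℕ => a + d * i ∈ S)).card : ℝ) := by
    simp [ind]
  rw [e1]
  refine (Nat.cast_le.2 h).trans ?_
  rw [Nat.cast_add, Finset.card_filter, Nat.cast_sum]
  gcongr with q hq
  by_cases hc : q.1 ∈ (Finset.Icc 1 N).filter (fun i : ℕ => a + d * i ∈ S) ∧
    q.1 + q.2 ∈ (Finset.Icc 1 N).filter (fun i : ℕ => a + d * i ∈ S) ∧
    q.1 + 2 * q.2 ∈ (Finset.Icc 1 N).filter (fun i : ℕ => a + d * i ∈ S)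
  · rw [if_pos hc]
    obtain ⟨c1, c2, c3⟩ := hc
    have c1 := (Finset.mem_filter.1 c1).2
    have c2 := (Finset.mem_filter.1 c2).2
    have c3 := (Finset.mem_filter.1 c3).2
    have e2 : a + d * ((q.1 + q.2 : ℕ) : ZMod p) = a + d * (q.1 : ℕ) + d * (q.2 : ℕ) := by
      push_cast; ring
    have e3 : a + d * ((q.1 + 2 * q.2 : ℕ) : ZMod p) =
        a + d * (q.1 : ℕ) + 2 * (d * (q.2 : ℕ)) := by
      push_cast; ring
    rw [e2] at c2
    rw [e3] at c3
    simp [ind, c1, c2, c3]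
  · rw [if_neg hc]
    have : ∀ x, 0 ≤ ind p S x := by intro x; unfold ind; split_ifs <;> norm_num
    rw [Nat.cast_zero]
    exact mul_nonneg (mul_nonneg (this _) (this _)) (this _)

theorem change_aux (p : ℕ) [Fact p.Prime] (f : ZMod p → ℝ) (i e : ZMod p) (he : e ≠ 0) :
    ∑ d : ZMod p, ∑ a : ZMod p, f (a + d * i) * f (a + d * i + d * e) *
      f (a + d * i + 2 * (d * e)) =
    ∑ n : ZMod p, ∑ d : ZMod p, f n * f (n + d) * f (n + 2 * d) := by
  have h1 : ∀ d : ZMod p, ∑ a : ZMod p, f (a + d * i) * f (a + d * i + d * e) *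
      f (a + d * i + 2 * (d * e)) = ∑ n : ZMod p, f n * f (n + d * e) * f (n + 2 * (d * e)) :=
    fun d => Equiv.sum_comp (Equiv.addRight (d * i))
      (fun n => f n * f (n + d * e) * f (n + 2 * (d * e)))
  rw [Finset.sum_congr rfl (fun d _ => h1 d), Finset.sum_comm]
  exact Finset.sum_congr rfl fun n _ => Equiv.sum_comp (Equiv.mulRight₀ e he)
      (fun d => f n * f (n + d) * f (n + 2 * d))

theorem stmt_5 :
    ∃ C : ℝ, 0 < C ∧
      ∀ (p : ℕ) [Fact p.Prime],
        ∀ N : ℕ, 2 ≤ N → N ≤ p →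
          ∀ S : Finset (ZMod p),
            (S.card : ℝ) ≥ 2 * ((r3 N : ℝ) / N) * p →
            Lam p (ind p S) ≥ 2 * (r3 N : ℝ) / ((N : ℝ) ^ 3 + C * (N : ℝ) ^ 2) := by
  refine ⟨2, by norm_num, ?_⟩
  intro p hp N hN hNp S hS
  have hp0 : (0 : ℝ) < p := by exact_mod_cast hp.out.pos
  have hN0 : (0 : ℝ) < N := by exact_mod_cast (by omega : 0 < N)
  set T : ℝ := ∑ n : ZMod p, ∑ d : ZMod p, ind p S n * ind p S (n + d) * ind p S (n + 2 * d)
    with hT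
  have hT0 : 0 ≤ T := by
    have : ∀ x, 0 ≤ ind p S x := by intro x; unfold ind; split_ifs <;> norm_num
    exact Finset.sum_nonneg fun n _ => Finset.sum_nonneg fun d _ =>
      mul_nonneg (mul_nonneg (this _) (this _)) (this _)
  have hsum := Finset.sum_le_sum (s := (Finset.univ : Finset (ZMod p))) fun d _ =>
    Finset.sum_le_sum (s := (Finset.univ : Finset (ZMod p))) fun a _ => pointwise_aux p N S a d
  have hL : ∑ d : ZMod p, ∑ a : ZMod p, ∑ i ∈ Finset.Icc 1 N, ind p S (a + d * i) =
      p * (N * S.card) := by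
    have : ∀ d : ZMod p, ∑ a : ZMod p, ∑ i ∈ Finset.Icc 1 N, ind p S (a + d * i) =
        N * S.card := by
      intro d
      rw [Finset.sum_comm]
      have h2 : ∀ i ∈ Finset.Icc 1 N, ∑ a : ZMod p, ind p S (a + d * i) = S.card := by
        intro i _
        refine (Equiv.sum_comp (Equiv.addRight (d * (i : ZMod p))) (ind p S)).trans ?_
        simp [ind]
      rw [Finset.sum_congr rfl h2]
      simp
    rw [Finset.sum_congr rfl fun d _ => this d]
    simp [ZMod.card]
  rw [hL] at hsum
  simp only [Finset.sum_add_distrib] at hsum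
  have hR : ∑ d : ZMod p, ∑ a : ZMod p, ∑ q ∈ (Finset.Icc 1 N) ×ˢ (Finset.Ico 1 N),
        ind p S (a + d * (q.1 : ℕ)) *
        ind p S (a + d * (q.1 : ℕ) + d * (q.2 : ℕ)) *
        ind p S (a + d * (q.1 : ℕ) + 2 * (d * (q.2 : ℕ))) = N * ((N - 1 : ℕ) : ℝ) * T := by
    rw [Finset.sum_congr rfl fun d _ => Finset.sum_comm, Finset.sum_comm]
    have h3 : ∀ q ∈ (Finset.Icc 1 N) ×ˢ (Finset.Ico 1 N), ∑ d : ZMod p, ∑ a : ZMod p,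
        ind p S (a + d * (q.1 : ℕ)) *
        ind p S (a + d * (q.1 : ℕ) + d * (q.2 : ℕ)) *
        ind p S (a + d * (q.1 : ℕ) + 2 * (d * (q.2 : ℕ))) = T := by
      intro q hq
      apply change_aux
      rw [Finset.mem_product, Finset.mem_Ico] at hq
      intro h0
      rw [ZMod.natCast_eq_zero_iff] at h0
      have := Nat.le_of_dvd (by omega) h0
      omega
    rw [Finset.sum_congr rfl h3]
    simp
  rw [hR] at hsum
  simp only [Finset.sum_const, Finset.card_univ, ZMod.card, nsmul_eq_mul] at hsum
  have hS' : 2 * (r3 N : ℝ) * p ≤ N * S.card := by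
    calc 2 * (r3 N : ℝ) * p = N * (2 * ((r3 N : ℝ) / N) * p) := by field_simp
      _ ≤ _ := by gcongr
  have hN1 : ((N - 1 : ℕ) : ℝ) ≤ N := by exact_mod_cast Nat.sub_le N 1
  have h4 : N * ((N - 1 : ℕ) : ℝ) * T ≤ N * N * T := by gcongr
  have h5 := mul_le_mul_of_nonneg_left hS' hp0.le
  have h6 : (r3 N : ℝ) * p ^ 2 ≤ N ^ 2 * T := by nlinarith
  have h7 : (r3 N : ℝ) / N ^ 2 ≤ Lam p (ind p S) := by
    unfold Lam
    rw [← hT, div_le_iff₀ (by positivity), inv_mul_eq_div, div_mul_eq_mul_div,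
      le_div_iff₀ (by positivity)]
    linarith
  refine le_trans ?_ h7
  rw [div_le_div_iff₀ (by positivity) (by positivity)]
  have : 0 ≤ (r3 N : ℝ) * N ^ 3 := by positivity
  nlinarith
end

section
/- There is an absolute constant K > 0 such that the following holds for every odd prime p and every θ ∈ (0,1]: suppose f : 𝔽_p → [0,1] satisfies 𝔼(f) ≥ θ and Λ(f) ≤ Λ(g) for every g : 𝔽_p → [0,1] with 𝔼(g) ≥ θ. Then for every ε with p^{−1/12}·log p < ε < 1/3, the intermediate level set A := { n ∈ 𝔽_p : ε ≤ f(n) ≤ 1 − ε } satisfies Λ(A) ≤ K·ε^{−6}·p^{−1/2}·log p. -/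
/-- a mean zero function with very negative count of 3-APs -/
lemma exists_phi (p : ℕ) [Fact p.Prime] (hp2 : (2 : ZMod p) ≠ 0) :
    ∃ φ : ZMod p → ℝ, (∀ n, |φ n| ≤ 1) ∧ ∑ n, φ n = 0 ∧
      ∑ n, ∑ d, φ n * φ (n + d) * φ (n + 2 * d) ≤ -((p : ℝ) ^ 2 / 64) := by
  set ψ : AddChar (ZMod p) ℂ := ZMod.stdAddChar with hψ
  have hprim : ψ.IsPrimitive := ZMod.isPrimitive_stdAddChar p
  let r : Fin 4 → ZMod p := ![1, -2, -1, 2]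
  let φ : ZMod p → ℝ := fun n => -(1/4) * ∑ i, (ψ (n * r i)).re
  have hconj : ∀ x, ψ (-x) = (starRingEnd ℂ) (ψ x) := by
    intro x
    exact AddChar.map_neg_eq_conj ψ x
  have hφ : ∀ n, ((φ n : ℝ) : ℂ) = -(1/4) * ∑ i, ψ (n * r i) := by
    intro n
    simp only [φ, r, Fin.sum_univ_four]
    simp only [Matrix.cons_val_zero, Matrix.cons_val_one, Matrix.cons_val, mul_neg, hconj, Complex.conj_re]
    apply Complex.ext <;> simp
  have hsum : ∀ c : ZMod p, ∑ n, ψ (n * c) = if c = 0 then (p : ℂ) else 0 := by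
    intro c
    rw [AddChar.sum_mulShift c hprim]
    simp [ZMod.card]
  refine ⟨φ, ?_, ?_, ?_⟩
  · intro n
    have h : ∀ i, |(ψ (n * r i)).re| ≤ 1 := by
      intro i
      refine (Complex.abs_re_le_norm _).trans ?_
      rw [AddChar.norm_apply]
    have := Finset.abs_sum_le_sum_abs (fun i => (ψ (n * r i)).re) Finset.univ
    have h2 : ∑ i, |(ψ (n * r i)).re| ≤ ∑ i : Fin 4, (1:ℝ) := Finset.sum_le_sum fun i _ => h i
    simp at h2
    simp only [φ, abs_mul]
    norm_num
    linarith
  · have : ((∑ n, φ n : ℝ) : ℂ) = 0 := by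
      push_cast
      simp only [hφ, ← Finset.mul_sum]
      rw [Finset.sum_comm]
      simp only [hsum]
      have h0 : ∀ i, r i ≠ 0 := by
        intro i
        fin_cases i <;> simp [r, hp2]
      simp [h0]
    exact_mod_cast this
  · have key : ((∑ n, ∑ d, φ n * φ (n + d) * φ (n + 2 * d) : ℝ) : ℂ) =
        ((-(1/64) * ∑ i, ∑ j, ∑ k, (if r i + r j + r k = 0 ∧ r j + 2 * r k = 0 then (p:ℝ)^2 else 0) : ℝ) : ℂ) := by
      push_cast
      simp only [hφ]
      have h1 : ∀ n d : ZMod p, (-(1/4) * ∑ i, ψ (n * r i)) * (-(1/4) * ∑ i, ψ ((n+d) * r i)) *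
          (-(1/4) * ∑ i, ψ ((n+2*d) * r i)) = -(1/64) * ∑ i, ∑ j, ∑ k,
            ψ (n * (r i + r j + r k)) * ψ (d * (r j + 2 * r k)) := by
        intro n d
        have : ∀ a b c : ℂ, (-(1/4) * a) * (-(1/4) * b) * (-(1/4) * c) = -(1/64) * (a * b * c) := by
          intros; ring
        rw [this, Finset.sum_mul_sum]
        congr 1
        rw [Finset.sum_mul]
        refine Finset.sum_congr rfl fun i _ => ?_
        rw [Finset.sum_mul]
        refine Finset.sum_congr rfl fun j _ => ?_
        rw [Finset.mul_sum]
        refine Finset.sum_congr rfl fun k _ => ?_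
        rw [← AddChar.map_add_eq_mul, ← AddChar.map_add_eq_mul, ← AddChar.map_add_eq_mul]
        congr 1
        ring
      simp only [h1, ← Finset.mul_sum]
      congr 1
      have h2 : ∀ n : ZMod p, ∑ d, ∑ i, ∑ j, ∑ k, ψ (n * (r i + r j + r k)) * ψ (d * (r j + 2 * r k))
          = ∑ i, ∑ j, ∑ k, ψ (n * (r i + r j + r k)) * ∑ d, ψ (d * (r j + 2 * r k)) := by
        intro n
        simp only [Finset.mul_sum]
        rw [Finset.sum_comm]
        refine Finset.sum_congr rfl fun i _ => ?_
        rw [Finset.sum_comm]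
        refine Finset.sum_congr rfl fun j _ => ?_
        rw [Finset.sum_comm]
      simp only [h2]
      rw [Finset.sum_comm]
      refine Finset.sum_congr rfl fun i _ => ?_
      rw [Finset.sum_comm]
      refine Finset.sum_congr rfl fun j _ => ?_
      rw [Finset.sum_comm]
      refine Finset.sum_congr rfl fun k _ => ?_
      rw [← Finset.sum_mul, hsum, hsum]
      by_cases ha : r i + r j + r k = 0 <;> by_cases hb : r j + 2 * r k = 0 <;> simp [ha, hb, sq]
    have key' : ∑ n, ∑ d, φ n * φ (n + d) * φ (n + 2 * d) =
        -(1/64) * ∑ i, ∑ j, ∑ k, (if r i + r j + r k = 0 ∧ r j + 2 * r k = 0 then (p:ℝ)^2 else 0) := by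
      exact_mod_cast key
    rw [key']
    have hnn : ∀ i j k, 0 ≤ (if r i + r j + r k = 0 ∧ r j + 2 * r k = 0 then (p:ℝ)^2 else 0) := by
      intro i j k; split_ifs <;> positivity
    have s1 := Finset.single_le_sum (f := fun i => ∑ j, ∑ k, (if r i + r j + r k = 0 ∧ r j + 2 * r k = 0 then (p:ℝ)^2 else 0))
      (fun i _ => Finset.sum_nonneg fun j _ => Finset.sum_nonneg fun k _ => hnn i j k) (Finset.mem_univ 0)
    have s2 := Finset.single_le_sum (f := fun j => ∑ k, (if r 0 + r j + r k = 0 ∧ r j + 2 * r k = 0 then (p:ℝ)^2 else 0))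
      (fun j _ => Finset.sum_nonneg fun k _ => hnn 0 j k) (Finset.mem_univ 1)
    have s3 := Finset.single_le_sum (f := fun k => (if r 0 + r 1 + r k = 0 ∧ r 1 + 2 * r k = 0 then (p:ℝ)^2 else 0))
      (fun k _ => hnn 0 1 k) (Finset.mem_univ 0)
    have hc : r 0 + r 1 + r 0 = 0 ∧ r 1 + 2 * r 0 = 0 := by
      constructor <;> simp [r] 
      norm_num
    simp only [hc] at s1 s2 s3
    simp at s1 s2 s3
    linarith

lemma affine_sums (p : ℕ) [Fact p.Prime] (φ : ZMod p → ℝ) (h0 : ∑ n, φ n = 0) :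
    (∀ x, ∑ w : ZMod p × ZMod p, φ (w.1 * x + w.2) = 0) ∧
    (∀ x y, x ≠ y → ∑ w : ZMod p × ZMod p, φ (w.1 * x + w.2) * φ (w.1 * y + w.2) = 0) ∧
    (∀ n d, d ≠ 0 → ∑ w : ZMod p × ZMod p,
      φ (w.1 * n + w.2) * φ (w.1 * (n + d) + w.2) * φ (w.1 * (n + 2 * d) + w.2) =
      ∑ n, ∑ d, φ n * φ (n + d) * φ (n + 2 * d)) := by
  refine ⟨?_, ?_, ?_⟩
  · intro x
    rw [Fintype.sum_prod_type]
    refine Finset.sum_eq_zero fun a _ => ?_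
    rw [← h0]
    exact Equiv.sum_comp (Equiv.addLeft (a * x)) φ
  · intro x y hxy
    rw [Fintype.sum_prod_type]
    have h : ∀ a, ∑ b, φ (a * x + b) * φ (a * y + b) = ∑ b, φ b * φ (a * (y - x) + b) := by
      intro a
      rw [← Equiv.sum_comp (Equiv.addLeft (a * x)) (fun b => φ b * φ (a * (y - x) + b))]
      refine Finset.sum_congr rfl fun b _ => ?_
      simp only [Equiv.coe_addLeft]
      congr 2
      ring
    simp only [h]
    rw [Finset.sum_comm]
    refine Finset.sum_eq_zero fun b _ => ?_
    rw [← Finset.mul_sum]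
    have hd : y - x ≠ 0 := sub_ne_zero.mpr hxy.symm
    have := Equiv.sum_comp ((Equiv.mulRight₀ (y - x) hd).trans (Equiv.addRight b)) φ
    simp only [Equiv.trans_apply, Equiv.mulRight₀_apply, Equiv.coe_addRight] at this
    rw [this, h0, mul_zero]
  · intro n d hd
    rw [Fintype.sum_prod_type]
    have h : ∀ a, ∑ b, φ (a * n + b) * φ (a * (n + d) + b) * φ (a * (n + 2 * d) + b) =
        ∑ b, φ b * φ (b + a * d) * φ (b + 2 * (a * d)) := by
      intro a
      rw [← Equiv.sum_comp (Equiv.addLeft (a * n)) (fun b => φ b * φ (b + a * d) * φ (b + 2 * (a * d)))]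
      refine Finset.sum_congr rfl fun b _ => ?_
      simp only [Equiv.coe_addLeft]
      congr 2
      · congr 1; ring
      · ring
    simp only [h]
    rw [Finset.sum_comm]
    refine Finset.sum_congr rfl fun b _ => ?_
    exact Equiv.sum_comp (Equiv.mulRight₀ d hd) (fun e => φ b * φ (b + e) * φ (b + 2 * e))

/-- reindexing of pairs inside an arithmetic progression -/
lemma reindex (p : ℕ) [Fact p.Prime] (hp2 : (2 : ZMod p) ≠ 0) (G : ZMod p → ZMod p → ℝ) :
    (∑ n, ∑ d, G n (n + d) = ∑ x, ∑ y, G x y) ∧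
    (∑ n, ∑ d, G n (n + 2 * d) = ∑ x, ∑ y, G x y) ∧
    (∑ n, ∑ d, G (n + d) (n + 2 * d) = ∑ x, ∑ y, G x y) := by
  have h1 : ∑ n, ∑ d, G n (n + d) = ∑ x, ∑ y, G x y :=
    Finset.sum_congr rfl fun n _ => Equiv.sum_comp (Equiv.addLeft n) (G n)
  refine ⟨h1, ?_, ?_⟩
  · rw [← h1]
    exact Finset.sum_congr rfl fun n _ =>
      Equiv.sum_comp (Equiv.mulLeft₀ 2 hp2) (fun d => G n (n + d))
  · rw [← h1, Finset.sum_comm]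
    conv_rhs => rw [Finset.sum_comm]
    refine Finset.sum_congr rfl fun d _ => ?_
    rw [← Equiv.sum_comp (Equiv.addRight d) (fun n => G n (n + d))]
    refine Finset.sum_congr rfl fun n _ => ?_
    simp only [Equiv.coe_addRight]
    congr 1
    ring

lemma cubic_ineq (u v w m : ℝ) (hu : |u| ≤ 1) (hv : |v| ≤ 1) (hw : |w| ≤ 1) (hm : |m| ≤ 1) :
    (u - m) * (v - m) * (w - m) ≤ u * v * w + 1 / 128 + 1568 * m ^ 2 := by
  have e : (u - m) * (v - m) * (w - m) - u * v * w =
      m * (-(u * v + u * w + v * w) + m * (u + v + w) - m * m) := by ring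
  have b : ∀ x y : ℝ, |x| ≤ 1 → |y| ≤ 1 → |x * y| ≤ 1 := by
    intro x y hx hy
    rw [abs_mul]
    exact mul_le_one₀ hx (abs_nonneg _) hy
  have k1 := abs_le.mp (b u v hu hv)
  have k2 := abs_le.mp (b u w hu hw)
  have k3 := abs_le.mp (b v w hv hw)
  have k4 := abs_le.mp (b m u hm hu)
  have k5 := abs_le.mp (b m v hm hv)
  have k6 := abs_le.mp (b m w hm hw)
  have k7 := abs_le.mp (b m m hm hm)
  have q : |-(u * v + u * w + v * w) + m * (u + v + w) - m * m| ≤ 7 := by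
    rw [abs_le]; constructor <;> nlinarith
  have : m * (-(u * v + u * w + v * w) + m * (u + v + w) - m * m) ≤ |m| * 7 := by
    refine (le_abs_self _).trans ?_
    rw [abs_mul]
    exact mul_le_mul_of_nonneg_left q (abs_nonneg _)
  have h2 : |m| * 7 ≤ 1 / 128 + 1568 * m ^ 2 := by
    rw [← sq_abs m]
    nlinarith [sq_nonneg (448 * |m| - 1)]
  linarith

set_option maxHeartbeats 1000000 in
lemma main_bound (p : ℕ) [Fact p.Prime] (hp2 : (2 : ZMod p) ≠ 0)
    {Ω : Type} [Fintype Ω] (φ : Ω → ZMod p → ℝ) (N : ℝ) (hN : (Fintype.card Ω : ℝ) = N) (hN0 : 0 < N)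
    (hb : ∀ w n, |φ w n| ≤ 1)
    (h1 : ∀ x, ∑ w, φ w x = 0)
    (h2 : ∀ x y, x ≠ y → ∑ w, φ w x * φ w y = 0)
    (h3 : ∀ n d, d ≠ 0 → ∑ w, φ w n * φ w (n + d) * φ w (n + 2 * d) ≤ -(N / 64))
    (f : ZMod p → ℝ) (hf : ∀ n, f n ∈ Set.Icc (0 : ℝ) 1)
    (hmin : ∀ g : ZMod p → ℝ, (∀ n, g n ∈ Set.Icc (0 : ℝ) 1) → Ex p g = Ex p f →
              Lam p f ≤ Lam p g)
    (δ : ℝ) (hδ : 0 < δ) (hδ1 : δ ≤ 1)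
    (A : Finset (ZMod p)) (hA : ∀ n ∈ A, 2 * δ ≤ f n ∧ f n ≤ 1 - 2 * δ) :
    Lam p (ind p A) ≤ 203648 / (δ * p) := by
  have hp : (0 : ℝ) < p := by exact_mod_cast (Fact.out : p.Prime).pos
  rcases A.eq_empty_or_nonempty with rfl | hne
  · have : Lam p (ind p ∅) = 0 := by simp [Lam, ind]
    rw [this]; positivity
  have hc0 : (0 : ℝ) < A.card := by exact_mod_cast hne.card_pos
  set c : ℝ := (A.card : ℝ) with hc
  have hcp : c ≤ p := by
    have := Finset.card_le_univ A
    rw [ZMod.card] at this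
    rw [hc]
    exact_mod_cast this
  set a : ZMod p → ℝ := ind p A with ha
  have haA : ∀ n ∈ A, a n = 1 := fun n hn => by simp [ha, ind, hn]
  have haN : ∀ n, n ∉ A → a n = 0 := fun n hn => by simp [ha, ind, hn]
  have ha01 : ∀ n, a n = 0 ∨ a n = 1 := by
    intro n; simp only [ha, ind]; split_ifs <;> simp
  have ha0 : ∀ n, 0 ≤ a n := fun n => by rcases ha01 n with h | h <;> rw [h]; norm_num
  have ha1 : ∀ n, a n ≤ 1 := fun n => by rcases ha01 n with h | h <;> rw [h]; norm_num
  have hasum : ∑ n, a n = c := by simp [ha, ind, hc]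
  have hsa : ∀ g : ZMod p → ℝ, ∑ n ∈ A, g n = ∑ n, a n * g n := by
    intro g; simp [ha, ind]
  let m : Ω → ℝ := fun w => c⁻¹ * ∑ n ∈ A, φ w n
  have hm1 : ∀ w, |m w| ≤ 1 := by
    intro w
    simp only [m, abs_mul, abs_inv, abs_of_pos hc0]
    rw [inv_mul_le_iff₀ hc0, mul_one]
    refine (Finset.abs_sum_le_sum_abs _ _).trans ?_
    refine (Finset.sum_le_sum fun n _ => hb w n).trans ?_
    simp [hc]
  have hcm : ∀ w, ∑ n ∈ A, φ w n = c * m w := by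
    intro w; simp only [m]; field_simp
  have hsq : ∀ x, ∑ w, φ w x * φ w x ≤ N := by
    intro x
    have : ∑ w, φ w x * φ w x ≤ ∑ w : Ω, (1:ℝ) := Finset.sum_le_sum fun w _ => by
      have := abs_le.mp (hb w x); nlinarith
    simpa [hN] using this
  have hsq0 : ∀ x, 0 ≤ ∑ w, φ w x * φ w x := fun x =>
    Finset.sum_nonneg fun w _ => mul_self_nonneg _
  have hmφ : ∀ x ∈ A, ∑ w, m w * φ w x = c⁻¹ * ∑ w, φ w x * φ w x := by
    intro x hx
    simp only [m, mul_assoc, ← Finset.mul_sum]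
    congr 1
    simp only [Finset.sum_mul]
    rw [Finset.sum_comm]
    rw [Finset.sum_eq_single_of_mem x hx]
    intro y _ hy
    exact h2 y x hy
  have hmφ0 : ∀ x ∈ A, 0 ≤ ∑ w, m w * φ w x := fun x hx => by
    rw [hmφ x hx]; exact mul_nonneg (inv_nonneg.mpr hc0.le) (hsq0 x)
  have hmφ1 : ∀ x ∈ A, ∑ w, m w * φ w x ≤ N / c := fun x hx => by
    rw [hmφ x hx, div_eq_inv_mul]; exact mul_le_mul_of_nonneg_left (hsq x) (inv_nonneg.mpr hc0.le)
  have hmm : ∑ w, m w ^ 2 ≤ N / c := by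
    have e : c * ∑ w, m w ^ 2 = ∑ x ∈ A, ∑ w, m w * φ w x := by
      rw [Finset.sum_comm, Finset.mul_sum]
      refine Finset.sum_congr rfl fun w _ => ?_
      rw [← Finset.mul_sum, hcm]; ring
    have : c * ∑ w, m w ^ 2 ≤ c * (N / c) := by
      rw [e]
      refine (Finset.sum_le_sum hmφ1).trans ?_
      simp [hc]
    exact le_of_mul_le_mul_left this hc0
  have hmm0 : 0 ≤ ∑ w, m w ^ 2 := Finset.sum_nonneg fun w _ => sq_nonneg _
  let X : Ω → ZMod p → ℝ := fun w n => a n * (φ w n - m w)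
  have hX2 : ∀ w n, |X w n| ≤ 2 * a n := by
    intro w n
    simp only [X, abs_mul, abs_of_nonneg (ha0 n)]
    have : |φ w n - m w| ≤ 2 := by
      have := abs_sub (φ w n) (m w)
      have := hb w n
      have := hm1 w
      linarith
    nlinarith [ha0 n]
  have hXn : ∀ w, ∑ n, X w n = 0 := by
    intro w
    simp only [X]
    rw [← hsa (fun n => φ w n - m w), Finset.sum_sub_distrib, hcm]
    simp [hc]
  have hmsum : ∑ w, m w = 0 := by
    simp only [m, ← Finset.mul_sum]
    rw [Finset.sum_comm]
    simp [h1]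
  have hXw : ∀ n, ∑ w, X w n = 0 := by
    intro n
    simp only [X, ← Finset.mul_sum, Finset.sum_sub_distrib, h1, hmsum]
    simp
  -- covariances
  let C : ZMod p → ZMod p → ℝ := fun x y => ∑ w, X w x * X w y
  have hC : ∀ x y, |C x y| ≤ a x * a y * (3 * (N / c)) + (if x = y then 4 * N * a x else 0) := by
    intro x y
    have hNc : 0 ≤ N / c := div_nonneg hN0.le hc0.le
    by_cases hxy : x = y
    · subst hxy
      have : |C x x| ≤ ∑ w : Ω, 4 * a x := by
        refine (Finset.abs_sum_le_sum_abs _ _).trans (Finset.sum_le_sum fun w _ => ?_)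
        rw [abs_mul]
        have := hX2 w x
        have h0 := abs_nonneg (X w x)
        rcases ha01 x with h | h <;> rw [h] at this ⊢ <;> nlinarith
      simp [hN] at this
      have h0 : 0 ≤ a x * a x * (3 * (N / c)) := 
        mul_nonneg (mul_nonneg (ha0 x) (ha0 x)) (mul_nonneg (by norm_num) hNc)
      simp only [if_true]
      linarith
    · simp only [hxy, if_false, add_zero]
      by_cases hx : x ∈ A
      · by_cases hy : y ∈ A
        · have hax : a x = 1 := haA x hx
          have hay : a y = 1 := haA y hy
          have : C x y = - ∑ w, m w * φ w x - ∑ w, m w * φ w y + ∑ w, m w ^ 2 := by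
            rw [← zero_sub, ← h2 x y hxy]
            simp only [C, X, hax, hay, ← Finset.sum_sub_distrib, ← Finset.sum_add_distrib]
            exact Finset.sum_congr rfl fun w _ => by ring
          rw [this, hax, hay, abs_le]
          have := hmφ0 x hx
          have := hmφ0 y hy
          have := hmφ1 x hx
          have := hmφ1 y hy
          constructor <;> linarith
        · have hay : a y = 0 := haN y hy
          simp [C, X, hay]
      · have hax : a x = 0 := haN x hx
        simp [C, X, hax]
  have hCsum : ∑ x, ∑ y, |C x y| ≤ 7 * N * p := by
    have : ∑ x, ∑ y, |C x y| ≤ ∑ x, ∑ y, (a x * a y * (3 * (N / c)) + (if x = y then 4 * N * a x else 0)) :=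
      Finset.sum_le_sum fun x _ => Finset.sum_le_sum fun y _ => hC x y
    have e : ∑ x, ∑ y, (a x * a y * (3 * (N / c)) + (if x = y then 4 * N * a x else 0)) = 7 * N * c := by
      simp only [Finset.sum_add_distrib, ← Finset.sum_mul, ← Finset.mul_sum, hasum]
      simp only [Finset.sum_ite_eq, Finset.mem_univ, if_true, ← Finset.mul_sum, hasum]
      field_simp
      ring
    rw [e] at this
    exact this.trans (mul_le_mul_of_nonneg_left hcp (by positivity))
  obtain ⟨r1, r2, r3⟩ := reindex p hp2 (fun x y => |C x y|)
  -- the quadratic form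
  let Q : Ω → ℝ := fun w => ∑ n, ∑ d, (f n * X w (n + d) * X w (n + 2 * d)
    + X w n * f (n + d) * X w (n + 2 * d) + X w n * X w (n + d) * f (n + 2 * d))
  let L : Ω → ℝ := fun w => ∑ n, ∑ d, (X w n * f (n + d) * f (n + 2 * d)
    + f n * X w (n + d) * f (n + 2 * d) + f n * f (n + d) * X w (n + 2 * d))
  let T : Ω → ℝ := fun w => ∑ n, ∑ d, X w n * X w (n + d) * X w (n + 2 * d)
  have hL : ∑ w, L w = 0 := by
    simp only [L]
    rw [Finset.sum_comm]
    refine Finset.sum_eq_zero fun n _ => ?_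
    rw [Finset.sum_comm]
    refine Finset.sum_eq_zero fun d _ => ?_
    simp only [Finset.sum_add_distrib, ← Finset.sum_mul, ← Finset.mul_sum, hXw]
    simp
  have hQ : ∑ w, Q w ≤ 21 * N * p := by
    have e : ∑ w, Q w = ∑ n, ∑ d, (f n * C (n + d) (n + 2 * d) + f (n + d) * C n (n + 2 * d)
        + f (n + 2 * d) * C n (n + d)) := by
      simp only [Q]
      rw [Finset.sum_comm]
      refine Finset.sum_congr rfl fun n _ => ?_
      rw [Finset.sum_comm]
      refine Finset.sum_congr rfl fun d _ => ?_
      simp only [C, Finset.mul_sum, ← Finset.sum_add_distrib]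
      exact Finset.sum_congr rfl fun w _ => by ring
    have hfC : ∀ k x y, f k * C x y ≤ |C x y| := by
      intro k x y
      have := hf k
      calc f k * C x y ≤ f k * |C x y| := mul_le_mul_of_nonneg_left (le_abs_self _) this.1
        _ ≤ 1 * |C x y| := mul_le_mul_of_nonneg_right this.2 (abs_nonneg _)
        _ = _ := one_mul _
    rw [e]
    have : ∑ n, ∑ d, (f n * C (n + d) (n + 2 * d) + f (n + d) * C n (n + 2 * d)
        + f (n + 2 * d) * C n (n + d)) ≤ ∑ n, ∑ d, (|C (n + d) (n + 2 * d)| + |C n (n + 2 * d)|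
        + |C n (n + d)|) :=
      Finset.sum_le_sum fun n _ => Finset.sum_le_sum fun d _ =>
        add_le_add (add_le_add (hfC _ _ _) (hfC _ _ _)) (hfC _ _ _)
    refine this.trans ?_
    simp only [Finset.sum_add_distrib]
    rw [r1, r2, r3]
    linarith
  -- the cubic form
  set S : ℝ := ∑ n, ∑ d, a n * a (n + d) * a (n + 2 * d) with hS
  have hSc : S ≤ c * c := by
    have e := (reindex p hp2 (fun x y => a x * a y)).1
    have e2 : ∑ x, ∑ y, a x * a y = c * c := by
      simp only [← Finset.mul_sum, ← Finset.sum_mul, hasum]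
    rw [← e2, ← e]
    refine Finset.sum_le_sum fun n _ => Finset.sum_le_sum fun d _ => ?_
    exact mul_le_of_le_one_right (mul_nonneg (ha0 _) (ha0 _)) (ha1 _)
  have hT : ∑ w, T w ≤ N * (-S / 128 + 1570 * p) := by
    have e : ∑ w, T w = ∑ n, ∑ d, ∑ w, X w n * X w (n + d) * X w (n + 2 * d) := by
      simp only [T]
      rw [Finset.sum_comm]
      refine Finset.sum_congr rfl fun n _ => ?_
      rw [Finset.sum_comm]
    have hterm : ∀ n d, ∑ w, X w n * X w (n + d) * X w (n + 2 * d) ≤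
        a n * a (n + d) * a (n + 2 * d) * (N * (-1 / 128 + 1568 / c)) +
          (if d = 0 then 2 * N * a n else 0) := by
      intro n d
      have hB0 : 0 ≤ a n * a (n + d) * a (n + 2 * d) := mul_nonneg (mul_nonneg (ha0 _) (ha0 _)) (ha0 _)
      have t1 : ∑ w, X w n * X w (n + d) * X w (n + 2 * d) ≤
          a n * a (n + d) * a (n + 2 * d) * (∑ w, φ w n * φ w (n + d) * φ w (n + 2 * d)
            + N * (1 / 128) + 1568 * (N / c)) := by
        calc ∑ w, X w n * X w (n + d) * X w (n + 2 * d)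
            = a n * a (n + d) * a (n + 2 * d) *
              ∑ w, (φ w n - m w) * (φ w (n + d) - m w) * (φ w (n + 2 * d) - m w) := by
              rw [Finset.mul_sum]
              exact Finset.sum_congr rfl fun w _ => by simp only [X]; ring
          _ ≤ _ := by
              refine mul_le_mul_of_nonneg_left ?_ hB0
              refine (Finset.sum_le_sum fun w _ =>
                cubic_ineq _ _ _ _ (hb w _) (hb w _) (hb w _) (hm1 w)).trans ?_
              simp only [Finset.sum_add_distrib, ← Finset.mul_sum, Finset.sum_const,
                Finset.card_univ, nsmul_eq_mul, hN]
              linarith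
      by_cases hd : d = 0
      · subst hd
        simp only [if_true, mul_zero, add_zero] at t1 ⊢
        have t2 : ∑ w, φ w n * φ w n * φ w n ≤ N := by
          have : ∑ w, φ w n * φ w n * φ w n ≤ ∑ w : Ω, (1:ℝ) := Finset.sum_le_sum fun w _ => by
            refine (le_abs_self _).trans ?_
            rw [abs_mul, abs_mul]
            exact mul_le_one₀ (mul_le_one₀ (hb w n) (abs_nonneg _) (hb w n)) (abs_nonneg _) (hb w n)
          simpa [hN] using this
        refine t1.trans ?_
        rcases ha01 n with h | h <;> rw [h]
        · simp
        · have : N * (-1 / 128 + 1568 / c) = -N/128 + 1568 * (N / c) := by ring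
          rw [this]; linarith
      · simp only [hd, if_false, add_zero]
        refine t1.trans (mul_le_mul_of_nonneg_left ?_ hB0)
        have := h3 n d hd
        have : N * (-1 / 128 + 1568 / c) = -N/128 + 1568 * (N / c) := by ring
        rw [this]; linarith
    rw [e]
    refine (Finset.sum_le_sum fun n _ => Finset.sum_le_sum fun d _ => hterm n d).trans ?_
    simp only [Finset.sum_add_distrib, ← Finset.sum_mul]
    simp only [Finset.sum_ite_eq', Finset.mem_univ, if_true, ← Finset.mul_sum, hasum]
    rw [← hS]
    have q1 : S / c ≤ c := by rw [div_le_iff₀ hc0]; exact hSc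
    have : S * (N * (-1 / 128 + 1568 / c)) + 2 * N * c = N * (-S / 128 + 1568 * (S / c) + 2 * c) := by
      ring
    rw [this]
    refine mul_le_mul_of_nonneg_left ?_ hN0.le
    linarith
  -- minimality
  have hge : ∀ w, 0 ≤ δ * L w + δ ^ 2 * Q w + δ ^ 3 * T w := by
    intro w
    have hg := hmin (fun n => f n + δ * X w n) ?_ ?_
    · have e : ∑ n, ∑ d, (f n + δ * X w n) * (f (n + d) + δ * X w (n + d)) *
          (f (n + 2 * d) + δ * X w (n + 2 * d)) =
          ∑ n, ∑ d, f n * f (n + d) * f (n + 2 * d) + (δ * L w + δ ^ 2 * Q w + δ ^ 3 * T w) := by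
        simp only [L, Q, T, Finset.mul_sum, ← Finset.sum_add_distrib]
        exact Finset.sum_congr rfl fun n _ => Finset.sum_congr rfl fun d _ => by ring
      simp only [Lam] at hg
      rw [e] at hg
      have := le_of_mul_le_mul_left hg (by positivity)
      linarith
    · intro n
      have hx := abs_le.mp (hX2 w n)
      by_cases hn : n ∈ A
      · have han : a n = 1 := haA n hn
        rw [han] at hx
        have := hA n hn
        constructor <;> nlinarith
      · have han : a n = 0 := haN n hn
        simpa [X, han] using hf n
    · simp only [Ex, Finset.sum_add_distrib, ← Finset.mul_sum, hXn]
      simp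
  have htot : 0 ≤ δ * ∑ w, L w + δ ^ 2 * ∑ w, Q w + δ ^ 3 * ∑ w, T w := by
    simp only [Finset.mul_sum, ← Finset.sum_add_distrib]
    exact Finset.sum_nonneg fun w _ => hge w
  rw [hL, mul_zero, zero_add] at htot
  have f1 : δ ^ 2 * N * 0 ≤ δ ^ 2 * N * (21 * p + δ * (-S / 128 + 1570 * p)) := by
    have := mul_le_mul_of_nonneg_left hQ (sq_nonneg δ)
    have := mul_le_mul_of_nonneg_left hT (pow_pos hδ 3).le
    nlinarith
  have f2 := le_of_mul_le_mul_left f1 (by positivity)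
  have f3 : S * δ ≤ 203648 * p := by
    have : δ * p ≤ 1 * p := mul_le_mul_of_nonneg_right hδ1 hp.le
    nlinarith
  have : Lam p a = S / p ^ 2 := by simp only [Lam, ← hS]; field_simp
  rw [this, div_le_div_iff₀ (by positivity) (by positivity)]
  nlinarith

theorem stmt_14 :
    ∃ K : ℝ, 0 < K ∧
      ∀ (p : ℕ) [Fact p.Prime], Odd p →
        ∀ θ : ℝ, θ ∈ Set.Ioc (0 : ℝ) 1 →
          ∀ f : ZMod p → ℝ, (∀ n, f n ∈ Set.Icc (0 : ℝ) 1) →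
            Ex p f ≥ θ →
            (∀ g : ZMod p → ℝ, (∀ n, g n ∈ Set.Icc (0 : ℝ) 1) → Ex p g ≥ θ →
              Lam p f ≤ Lam p g) →
            ∀ ε : ℝ, (p : ℝ) ^ (-(1 : ℝ)/12) * Real.log p < ε → ε < 1/3 →
              ∀ A : Finset (ZMod p), (∀ n, n ∈ A ↔ (ε ≤ f n ∧ f n ≤ 1 - ε)) →
                Lam p (ind p A) ≤ K * ε ^ (-(6 : ℝ)) * (p : ℝ) ^ (-(1 : ℝ)/2) * Real.log p := by
  refine ⟨407296, by norm_num, ?_⟩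
  intro p hpf hodd θ _ f hf hE hmin ε hε hε3 A hA
  have hpp : p.Prime := hpf.out
  have hp3 : 3 ≤ p := by
    have := hpp.two_le
    rcases hodd with ⟨k, hk⟩
    omega
  have hp : (0 : ℝ) < p := by exact_mod_cast hpp.pos
  have hp1 : (1 : ℝ) ≤ p := by exact_mod_cast hpp.one_le
  have hp2 : (2 : ZMod p) ≠ 0 := by
    intro h
    have : ((2 : ℕ) : ZMod p) = 0 := by exact_mod_cast h
    rw [ZMod.natCast_eq_zero_iff] at this
    have := Nat.le_of_dvd (by norm_num) this
    omega
  have hlog : 1 ≤ Real.log p := by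
    rw [Real.le_log_iff_exp_le hp]
    have h3 : (3 : ℝ) ≤ p := by exact_mod_cast hp3
    have := Real.exp_one_lt_d9
    linarith
  have hε0 : 0 < ε := lt_of_le_of_lt (by positivity) hε
  obtain ⟨φ, hφ1, hφ0, hφ3⟩ := exists_phi p hp2
  obtain ⟨a1, a2, a3⟩ := affine_sums p φ hφ0
  have key := main_bound p hp2 (Ω := ZMod p × ZMod p) (fun w n => φ (w.1 * n + w.2)) ((p : ℝ) ^ 2)
    (by simp [ZMod.card, sq]) (by positivity) (fun w n => hφ1 _) a1 a2
    (fun n d hd => by rw [a3 n d hd]; exact hφ3) f hf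
    (fun g hg he => hmin g hg (by rw [he]; exact hE)) (ε / 2) (by positivity) (by linarith) A
    (fun n hn => by
      have := (hA n).mp hn
      constructor <;> linarith)
  refine key.trans ?_
  have e1 : (203648 : ℝ) / (ε / 2 * p) = 407296 * ε⁻¹ * (p : ℝ)⁻¹ := by
    field_simp; norm_num
  rw [e1]
  have g1 : ε⁻¹ ≤ ε ^ (-(6 : ℝ)) := by
    rw [← Real.rpow_neg_one]
    exact Real.rpow_le_rpow_of_exponent_ge hε0 (by linarith) (by norm_num)
  have g2 : (p : ℝ)⁻¹ ≤ (p : ℝ) ^ (-(1 : ℝ)/2) := by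
    rw [← Real.rpow_neg_one]
    exact Real.rpow_le_rpow_of_exponent_le hp1 (by norm_num)
  calc 407296 * ε⁻¹ * (p : ℝ)⁻¹ ≤ 407296 * ε ^ (-(6 : ℝ)) * (p : ℝ) ^ (-(1 : ℝ)/2) := by gcongr
    _ ≤ _ := le_mul_of_one_le_right (by positivity) hlog
end
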